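/- Let k be a positive even integer and let G be the graph on k+1 vertices consisting of one vertex v₀ adjacent to all vertices of two disjoint cliques, each clique on k/2 vertices (and no other edges between the cliques). Then a tree T on k+1 vertices is contained in G if and only if there exists a vertex u ∈ V(T) such that the connected components of T − u can be partitioned into two families whose total numbers of vertices are k/2 and k/2. -/

import Mathlib

open SimpleGraph Finset

/-- `G` contains `T` if there is an injective map of the vertices of `T` into those of
`G` mapping edges of `T` to edges of `G`. -/
def Contains {V W : Type*} (G : SimpleGraph V) (T : SimpleGraph W) : Prop :=
  ∃ φ : W → V, Function.Injective φ ∧ ∀ ⦃x y⦄, T.Adj x y → G.Adj (φ x) (φ y)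

/-- The graph on `k+1` vertices consisting of one vertex (vertex `0`) adjacent to all
vertices of two disjoint cliques, each on `k/2` vertices. -/
def twoCliquesApex (k : ℕ) : SimpleGraph (Fin (k + 1)) :=
  SimpleGraph.fromRel (fun x y =>
    ((x : ℕ) = 0) ∨
    ((x : ℕ) ≠ 0 ∧ (y : ℕ) ≠ 0 ∧ ((x : ℕ) ≤ k / 2 ↔ (y : ℕ) ≤ k / 2)))

/-- A vertex labelling that is constant along edges is constant on connected components. -/
theorem SimpleGraph.Reachable.apply_eq {V α : Type*} {G : SimpleGraph V} {f : V → α}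
    (hf : ∀ ⦃x y⦄, G.Adj x y → f x = f y) {v w : V} (h : G.Reachable v w) : f v = f w := by
  obtain ⟨p⟩ := h
  induction p with
  | nil => rfl
  | cons hadj _ ih => exact (hf hadj).trans ih

theorem twoCliquesApex_adj {k : ℕ} {x y : Fin (k + 1)} :
    (twoCliquesApex k).Adj x y ↔
      x ≠ y ∧ ((x : ℕ) = 0 ∨ (y : ℕ) = 0 ∨ ((x : ℕ) ≤ k / 2 ↔ (y : ℕ) ≤ k / 2)) := by
  simp only [twoCliquesApex, SimpleGraph.fromRel_adj]
  tauto

/-- If a bijection `φ` sends `u` to `0`, then an interval of nonzero labels has as many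
`φ`-preimages in the complement of `u` as it has elements. -/
theorem ncard_preimage_Icc_of_bijective {k : ℕ} {φ : Fin (k + 1) → Fin (k + 1)}
    (hφ : Function.Bijective φ) {u : Fin (k + 1)} (hu : φ u = 0) {a b : ℕ}
    (ha : 0 < a) (hb : b ≤ k) :
    {w : ↥{v : Fin (k + 1) | v ≠ u} | a ≤ (φ w : ℕ) ∧ (φ w : ℕ) ≤ b}.ncard = b + 1 - a := by
  have hinj : Function.Injective (fun w : ↥{v : Fin (k + 1) | v ≠ u} => (φ w : ℕ)) :=
    fun x y h => Subtype.ext (hφ.1 (Fin.ext h))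
  rw [← Set.ncard_image_of_injective _ hinj]
  have himage : Set.image (fun w : ↥{v : Fin (k + 1) | v ≠ u} => (φ w : ℕ))
      {w | a ≤ (φ w : ℕ) ∧ (φ w : ℕ) ≤ b} = (Finset.Icc a b : Set ℕ) := by
    ext n
    simp only [Set.mem_image, Set.mem_ofPred_eq, Finset.coe_Icc, Set.mem_Icc]
    constructor
    · rintro ⟨w, hw, rfl⟩
      exact hw
    · intro hn
      obtain ⟨v, hv⟩ := hφ.2 ⟨n, by omega⟩
      have hvn : (φ v : ℕ) = n := by rw [hv]
      refine ⟨⟨v, ?_⟩, ?_, hvn⟩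
      · rintro rfl
        rw [hu] at hvn
        simp at hvn
        omega
      · simpa only [hvn] using hn
  rw [himage, Set.ncard_coe_finset, Nat.card_Icc]

theorem exists_balanced_of_contains {k : ℕ} (h2 : 2 ∣ k) {T : SimpleGraph (Fin (k + 1))}
    (h : Contains (twoCliquesApex k) T) :
    ∃ u : Fin (k + 1),
      ∃ c : (T.induce {v | v ≠ u}).ConnectedComponent → Bool,
        {w : ↥{v : Fin (k + 1) | v ≠ u} |
            c ((T.induce {v | v ≠ u}).connectedComponentMk w) = true}.ncard = k / 2 ∧
        {w : ↥{v : Fin (k + 1) | v ≠ u} |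
            c ((T.induce {v | v ≠ u}).connectedComponentMk w) = false}.ncard = k / 2 := by
  obtain ⟨φ, hinj, hadj⟩ := h
  have hφ : Function.Bijective φ := Finite.injective_iff_bijective.mp hinj
  obtain ⟨u, hu⟩ := hφ.2 0
  have hne : ∀ w : ↥{v : Fin (k + 1) | v ≠ u}, (φ w : ℕ) ≠ 0 := fun w hw =>
    w.2 (hinj ((Fin.ext hw).trans hu.symm))
  have hconst : ∀ ⦃x y⦄, (T.induce {v | v ≠ u}).Adj x y →
      decide ((φ x : ℕ) ≤ k / 2) = decide ((φ y : ℕ) ≤ k / 2) := by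
    intro x y hxy
    have := (twoCliquesApex_adj.mp (hadj hxy)).2
    simp only [decide_eq_decide]
    have := hne x
    have := hne y
    tauto
  refine ⟨u, ConnectedComponent.lift (fun w => decide ((φ w : ℕ) ≤ k / 2))
    (fun v w p _ => p.reachable.apply_eq hconst), ?_, ?_⟩
  · simp only [ConnectedComponent.lift_mk, decide_eq_true_eq]
    convert ncard_preimage_Icc_of_bijective hφ hu (a := 1) (b := k / 2) one_pos (by omega) using 2
    · ext w
      have := hne w
      simp only [Set.mem_ofPred_eq]
      omega
    · omega
  · simp only [ConnectedComponent.lift_mk, decide_eq_false_iff_not]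
    convert ncard_preimage_Icc_of_bijective hφ hu (a := k / 2 + 1) (b := k) (by omega) le_rfl using 2
    · ext w
      have := (φ w).2
      simp only [Set.mem_ofPred_eq]
      omega
    · omega

theorem contains_of_balanced {k : ℕ} {T : SimpleGraph (Fin (k + 1))} {u : Fin (k + 1)}
    (c : (T.induce {v | v ≠ u}).ConnectedComponent → Bool)
    (hc : ∀ b, {w : ↥{v : Fin (k + 1) | v ≠ u} |
      c ((T.induce {v | v ≠ u}).connectedComponentMk w) = b}.ncard = k / 2) :
    Contains (twoCliquesApex k) T := by
  let d : ↥{v : Fin (k + 1) | v ≠ u} → Bool :=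
    fun w => c ((T.induce {v | v ≠ u}).connectedComponentMk w)
  let e : ∀ b, {w | d w = b} ≃ Fin (k / 2) := fun b =>
    Finite.equivFinOfCardEq ((Nat.card_coe_set_eq _).trans (hc b))
  let g : ↥{v : Fin (k + 1) | v ≠ u} → ℕ := fun w =>
    e (d w) ⟨w, rfl⟩ + (if d w = true then 1 else k / 2 + 1)
  have hg : ∀ w, 0 < g w ∧ g w < k + 1 ∧ (g w ≤ k / 2 ↔ d w = true) := by
    intro w
    have := (e (d w) ⟨w, rfl⟩).2
    simp only [g]
    split_ifs with h <;> simp only [h] <;> grind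
  have hg_inj : Function.Injective g := by
    intro x y hxy
    have hd : d x = d y := by
      rw [Bool.eq_iff_iff, ← (hg x).2.2, ← (hg y).2.2, hxy]
    have he : ∀ b (hx : d x = b) (hy : d y = b),
        (e b ⟨x, hx⟩ : ℕ) = e b ⟨y, hy⟩ → x = y := fun b hx hy h =>
      congrArg Subtype.val ((e b).injective (Fin.ext h))
    have heq : ∀ w b (hw : d w = b),
        g w = e b ⟨w, hw⟩ + (if b = true then 1 else k / 2 + 1) := by
      rintro w _ rfl
      rfl
    rw [heq x _ rfl, heq y _ hd.symm] at hxy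
    exact he _ rfl hd.symm (Nat.add_right_cancel hxy)
  have hφ_inj : Function.Injective (fun v : Fin (k + 1) =>
      if h : v = u then (0 : Fin (k + 1)) else ⟨g ⟨v, h⟩, (hg _).2.1⟩) := by
    intro x y hxy
    by_cases hx : x = u <;> by_cases hy : y = u <;>
      simp only [hx, hy, dite_true, dite_false, Fin.ext_iff, Fin.val_zero] at hxy
    · rw [hx, hy]
    · have := (hg ⟨y, hy⟩).1
      omega
    · have := (hg ⟨x, hx⟩).1
      omega
    · exact congrArg Subtype.val (hg_inj hxy)
  refine ⟨_, hφ_inj, fun x y hxy => twoCliquesApex_adj.mpr ⟨hφ_inj.ne hxy.ne, ?_⟩⟩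
  by_cases hx : x = u
  · simp [hx]
  by_cases hy : y = u
  · simp [hy]
  right; right
  simp only [hx, hy, dite_false]
  have hadj : (T.induce {v | v ≠ u}).Adj ⟨x, hx⟩ ⟨y, hy⟩ := hxy
  have hd : d ⟨x, hx⟩ = d ⟨y, hy⟩ := congrArg c (ConnectedComponent.sound hadj.reachable)
  rw [(hg _).2.2, (hg _).2.2, hd]

/-- Let `k` be a positive even integer and `G` the graph consisting of one vertex complete
to two disjoint cliques on `k/2` vertices each. A tree `T` on `k+1` vertices is contained
in `G` iff there is a vertex `u` of `T` such that the connected components of `T - u` can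
be partitioned into two families whose total numbers of vertices are `k/2` and `k/2`. -/
theorem contains_twoCliquesApex_iff_balanced (k : ℕ) (hk : 0 < k) (h2 : 2 ∣ k)
    (T : SimpleGraph (Fin (k + 1))) (hT : T.IsTree) :
    Contains (twoCliquesApex k) T ↔
      ∃ u : Fin (k + 1),
        ∃ c : (T.induce {v | v ≠ u}).ConnectedComponent → Bool,
          {w : ↥{v : Fin (k + 1) | v ≠ u} |
              c ((T.induce {v | v ≠ u}).connectedComponentMk w) = true}.ncard = k / 2 ∧
          {w : ↥{v : Fin (k + 1) | v ≠ u} |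
              c ((T.induce {v | v ≠ u}).connectedComponentMk w) = false}.ncard = k / 2 := by
  refine ⟨exists_balanced_of_contains h2, ?_⟩
  rintro ⟨u, c, ht, hf⟩
  exact contains_of_balanced c (Bool.forall_bool.mpr ⟨hf, ht⟩)
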